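/- Let p ≥ 5 and let u : ℝ³ × ℝ → ℝ be twice continuously differentiable, satisfy ∂_t² u = Δu − |u|^{p−1}u on ℝ³ × ℝ (Δ the Laplacian in the space variable), and suppose there exists R > 0 such that u(·,t) vanishes outside the ball {|x| ≤ R} for every t ∈ ℝ. Then u ≡ 0. -/

import Mathlib

open MeasureTheory

/-- The `i`-th partial derivative in the space variable. -/
noncomputable def pder (v : (Fin 3 → ℝ) → ℝ) (i : Fin 3) (x : Fin 3 → ℝ) : ℝ :=
  deriv (fun s => v (Function.update x i s)) (x i)

/-- The Laplacian in the space variable: the sum of the three second partial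
derivatives. -/
noncomputable def lap (v : (Fin 3 → ℝ) → ℝ) (x : Fin 3 → ℝ) : ℝ :=
  ∑ i, deriv (fun s => deriv (fun s' => v (Function.update x i s')) s) (x i)

open Filter Topology

/-- The derivative of a function on space-time in the direction `w`. -/
noncomputable def dirDeriv (w : (Fin 3 → ℝ) × ℝ) (F : (Fin 3 → ℝ) × ℝ → ℝ)
    (q : (Fin 3 → ℝ) × ℝ) : ℝ :=
  fderiv ℝ F q w

/-- The `i`-th coordinate direction of space, as a direction of space-time. -/
def spaceDir (i : Fin 3) : (Fin 3 → ℝ) × ℝ := (Pi.single i 1, 0)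

/-- The time direction of space-time. -/
def timeDir : (Fin 3 → ℝ) × ℝ := (0, 1)

/-- `F` vanishes outside the cylinder of radius `R` in space-time. -/
def VanishesOutside (R : ℝ) (F : (Fin 3 → ℝ) × ℝ → ℝ) : Prop :=
  ∀ q, R ^ 2 < ∑ i, q.1 i ^ 2 → F q = 0

section Calculus

variable {F G : (Fin 3 → ℝ) × ℝ → ℝ} {w : (Fin 3 → ℝ) × ℝ}

lemma ContDiff.dirDeriv {m n : WithTop ℕ∞} (hF : ContDiff ℝ n F) (hmn : m + 1 ≤ n) :
    ContDiff ℝ m (dirDeriv w F) :=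
  (hF.fderiv_right hmn).clm_apply contDiff_const

lemma ContDiff.continuous_dirDeriv (hF : ContDiff ℝ 1 F) : Continuous (_root_.dirDeriv w F) :=
  (hF.dirDeriv (m := 0) (by simp)).continuous

lemma dirDeriv_comm (hF : ContDiff ℝ 2 F) (w₁ w₂ q : (Fin 3 → ℝ) × ℝ) :
    dirDeriv w₁ (dirDeriv w₂ F) q = dirDeriv w₂ (dirDeriv w₁ F) q := by
  have hd : DifferentiableAt ℝ (fderiv ℝ F) q :=
    (hF.fderiv_right (m := 1) (by norm_num)).differentiable (by norm_num) q
  have key : ∀ a b, dirDeriv a (dirDeriv b F) q = fderiv ℝ (fderiv ℝ F) q a b := by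
    intro a b
    have h := hd.hasFDerivAt.clm_apply (hasFDerivAt_const b q)
    change fderiv ℝ (fun y => fderiv ℝ F y b) q a = _
    rw [h.fderiv]
    simp
  rw [key, key]
  exact hF.contDiffAt.isSymmSndFDerivAt (by simp) w₁ w₂

lemma hasDerivAt_time (hF : Differentiable ℝ F) (x : Fin 3 → ℝ) (t : ℝ) :
    HasDerivAt (fun τ => F (x, τ)) (dirDeriv timeDir F (x, t)) t :=
  (hF (x, t)).hasFDerivAt.comp_hasDerivAt t ((hasDerivAt_const t x).prodMk (hasDerivAt_id t))

lemma hasDerivAt_space (hF : Differentiable ℝ F) (x : Fin 3 → ℝ) (t : ℝ) (i : Fin 3) (s : ℝ) :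
    HasDerivAt (fun σ => F (Function.update x i σ, t))
      (dirDeriv (spaceDir i) F (Function.update x i s, t)) s :=
  (hF (Function.update x i s, t)).hasFDerivAt.comp_hasDerivAt s
    ((hasDerivAt_update x i s).prodMk (hasDerivAt_const s t))

lemma VanishesOutside.dirDeriv {R : ℝ} (hF : VanishesOutside R F) :
    VanishesOutside R (dirDeriv w F) := by
  intro q hq
  have hopen : IsOpen {q : (Fin 3 → ℝ) × ℝ | R ^ 2 < ∑ i, q.1 i ^ 2} :=
    isOpen_lt (by fun_prop) (by fun_prop)
  have h : F =ᶠ[𝓝 q] fun _ => 0 := by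
    filter_upwards [hopen.mem_nhds hq] with y hy using hF y hy
  simp [_root_.dirDeriv, h.fderiv_eq]

end Calculus

section Integrals

variable {R : ℝ} {F : (Fin 3 → ℝ) × ℝ → ℝ}

lemma abs_le_of_sum_sq_le {x : Fin 3 → ℝ} (hR : 0 ≤ R) (hx : ∑ i, x i ^ 2 ≤ R ^ 2) (i : Fin 3) :
    |x i| ≤ R :=
  abs_le_of_sq_le_sq
    ((Finset.single_le_sum (f := fun j => x j ^ 2) (fun _ _ => sq_nonneg _)
      (Finset.mem_univ i)).trans hx) hR

lemma VanishesOutside.eq_zero_of_notMem (hR : 0 ≤ R) (hF : VanishesOutside R F)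
    {x : Fin 3 → ℝ} (hx : x ∉ Metric.closedBall 0 R) (t : ℝ) : F (x, t) = 0 := by
  refine hF _ (lt_of_not_ge fun h => hx ?_)
  rw [mem_closedBall_zero_iff, pi_norm_le_iff_of_nonneg hR]
  exact abs_le_of_sum_sq_le hR h

lemma VanishesOutside.hasCompactSupport (hR : 0 ≤ R) (hF : VanishesOutside R F) (t : ℝ) :
    HasCompactSupport fun x => F (x, t) :=
  HasCompactSupport.intro (isCompact_closedBall 0 R) fun _ hx => hF.eq_zero_of_notMem hR hx t

lemma VanishesOutside.integrable (hR : 0 ≤ R) (hF : VanishesOutside R F) (hc : Continuous F)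
    (t : ℝ) : Integrable fun x => F (x, t) :=
  (hc.comp (by fun_prop : Continuous fun x : Fin 3 → ℝ => (x, t))).integrable_of_hasCompactSupport
    (hF.hasCompactSupport hR t)

lemma integral_dirDeriv_spaceDir (hR : 0 ≤ R) (hF : VanishesOutside R F) (hC : ContDiff ℝ 1 F)
    (i : Fin 3) (t : ℝ) : ∫ x, dirDeriv (spaceDir i) F (x, t) = 0 := by
  have hd : ∀ x, HasFDerivAt (fun x => F (x, t))
      ((fderiv ℝ F (x, t)).comp (ContinuousLinearMap.inl ℝ (Fin 3 → ℝ) ℝ)) x := fun x =>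
    (hC.differentiable (by norm_num) (x, t)).hasFDerivAt.comp x
      (hasFDerivAt_prodMk_left x t)
  have he : ∀ x, fderiv ℝ (fun x => F (x, t)) x (Pi.single i 1)
      = dirDeriv (spaceDir i) F (x, t) := by
    intro x
    rw [(hd x).fderiv]
    simp [dirDeriv, spaceDir]
  have h := integral_mul_fderiv_eq_neg_fderiv_mul_of_integrable (μ := volume)
    (f := fun _ : Fin 3 → ℝ => (1 : ℝ)) (g := fun x => F (x, t)) (v := Pi.single i 1)
    (by simp)
    (by simpa [he] using hF.dirDeriv.integrable hR hC.continuous_dirDeriv t)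
    (by simpa using hF.integrable hR hC.continuous t)
    (fun _ _ => by fun_prop) (fun x _ => (hd x).differentiableAt)
  simpa [he] using h

lemma hasDerivAt_integral_time (hR : 0 ≤ R) (hF : VanishesOutside R F) (hC : ContDiff ℝ 1 F)
    (t : ℝ) :
    HasDerivAt (fun τ => ∫ x, F (x, τ)) (∫ x, dirDeriv timeDir F (x, t)) t := by
  have hcd : Continuous (dirDeriv timeDir F) := hC.continuous_dirDeriv
  obtain ⟨C, hCb⟩ := ((isCompact_closedBall (0 : Fin 3 → ℝ) R).prod
    (isCompact_closedBall t 1)).exists_bound_of_continuousOn hcd.continuousOn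
  refine (hasDerivAt_integral_of_dominated_loc_of_deriv_le
    (F := fun τ x => F (x, τ)) (F' := fun τ x => dirDeriv timeDir F (x, τ))
    (bound := (Metric.closedBall (0 : Fin 3 → ℝ) R).indicator fun _ => C)
    (Metric.closedBall_mem_nhds t one_pos)
    (Eventually.of_forall fun τ => (hF.integrable hR hC.continuous τ).aestronglyMeasurable)
    (hF.integrable hR hC.continuous t)
    (hF.dirDeriv.integrable hR hcd t).aestronglyMeasurable
    (Eventually.of_forall fun x τ hτ => ?_)
    ((integrable_indicator_iff measurableSet_closedBall).2
      (integrableOn_const (by exact (isCompact_closedBall _ _).measure_lt_top.ne)))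
    (Eventually.of_forall fun x τ _ =>
      hasDerivAt_time (hC.differentiable (by norm_num)) x τ)).2
  by_cases hx : x ∈ Metric.closedBall (0 : Fin 3 → ℝ) R
  · simpa [hx] using hCb (x, τ) ⟨hx, hτ⟩
  · simp [hx, hF.dirDeriv.eq_zero_of_notMem hR hx τ]

/-- If the density `F` satisfies `∂_t F = div Φ + G`, then `d/dt ∫ F = ∫ G`. -/
lemma hasDerivAt_integral_of_balance (hR : 0 ≤ R) (hF : VanishesOutside R F)
    (hC : ContDiff ℝ 1 F) {Φ : Fin 3 → (Fin 3 → ℝ) × ℝ → ℝ} {G : (Fin 3 → ℝ) × ℝ → ℝ}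
    (hΦ : ∀ i, VanishesOutside R (Φ i)) (hΦC : ∀ i, ContDiff ℝ 1 (Φ i))
    (h : ∀ q, dirDeriv timeDir F q = ∑ i, dirDeriv (spaceDir i) (Φ i) q + G q) (t : ℝ) :
    HasDerivAt (fun τ => ∫ x, F (x, τ)) (∫ x, G (x, t)) t := by
  have hint : ∀ i, Integrable fun x => dirDeriv (spaceDir i) (Φ i) (x, t) := fun i =>
    (hΦ i).dirDeriv.integrable hR (hΦC i).continuous_dirDeriv t
  have hG : ∫ x, G (x, t) = ∫ x, dirDeriv timeDir F (x, t) := by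
    have : ∀ x, G (x, t)
        = dirDeriv timeDir F (x, t) - ∑ i, dirDeriv (spaceDir i) (Φ i) (x, t) := by
      intro x
      rw [h]
      ring
    simp_rw [this]
    rw [integral_sub (hF.dirDeriv.integrable hR hC.continuous_dirDeriv t)
      (integrable_finsetSum _ fun i _ => hint i), integral_finsetSum _ fun i _ => hint i]
    simp [integral_dirDeriv_spaceDir hR (hΦ _) (hΦC _)]
  rw [hG]
  exact hasDerivAt_integral_time hR hF hC t

end Integrals

section DirDerivRules

variable {F G : (Fin 3 → ℝ) × ℝ → ℝ} {w q : (Fin 3 → ℝ) × ℝ}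

lemma dirDeriv_add (hF : Differentiable ℝ F) (hG : Differentiable ℝ G) :
    dirDeriv w (fun y => F y + G y) q = dirDeriv w F q + dirDeriv w G q := by
  simp [dirDeriv, fderiv_fun_add (hF q) (hG q)]

lemma dirDeriv_sub (hF : Differentiable ℝ F) (hG : Differentiable ℝ G) :
    dirDeriv w (fun y => F y - G y) q = dirDeriv w F q - dirDeriv w G q := by
  simp [dirDeriv, fderiv_fun_sub (hF q) (hG q)]

lemma dirDeriv_mul (hF : Differentiable ℝ F) (hG : Differentiable ℝ G) :
    dirDeriv w (fun y => F y * G y) q = F q * dirDeriv w G q + G q * dirDeriv w F q := by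
  simp [dirDeriv, fderiv_fun_mul (hF q) (hG q)]

lemma dirDeriv_const (c : ℝ) : dirDeriv w (fun _ => c) q = 0 := by
  simp [dirDeriv]

lemma dirDeriv_sq (hF : Differentiable ℝ F) :
    dirDeriv w (fun y => F y ^ 2) q = 2 * F q * dirDeriv w F q := by
  simp_rw [pow_two]
  rw [dirDeriv_mul hF hF]
  ring

lemma dirDeriv_coord (i : Fin 3) : dirDeriv w (fun y => y.1 i) q = w.1 i := by
  have h : HasFDerivAt (fun y : (Fin 3 → ℝ) × ℝ => y.1 i)
      ((ContinuousLinearMap.proj i).comp (ContinuousLinearMap.fst ℝ (Fin 3 → ℝ) ℝ)) q :=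
    ((ContinuousLinearMap.proj (R := ℝ) (φ := fun _ : Fin 3 => ℝ) i).comp
      (ContinuousLinearMap.fst ℝ (Fin 3 → ℝ) ℝ)).hasFDerivAt
  simp [dirDeriv, h.fderiv]

lemma dirDeriv_abs_rpow {p : ℝ} (hp : 0 < p) (hF : Differentiable ℝ F) :
    dirDeriv w (fun y => |F y| ^ (p + 1)) q
      = (p + 1) * (|F q| ^ (p - 1) * F q) * dirDeriv w F q := by
  have h := (hasDerivAt_abs_rpow (F q) (p := p + 1) (by linarith)).comp_hasFDerivAt q
    (hF q).hasFDerivAt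
  change fderiv ℝ ((fun x => |x| ^ (p + 1)) ∘ F) q w = _
  rw [h.fderiv, show p + 1 - 2 = p - 1 by ring]
  simp only [smul_apply, smul_eq_mul, dirDeriv]
  ring

lemma ContDiff.abs_rpow {p : ℝ} (hp : 0 < p) (hF : ContDiff ℝ 1 F) :
    ContDiff ℝ 1 fun y => |F y| ^ (p + 1) :=
  hF.norm_rpow (by linarith)

lemma abs_rpow_add_one {p : ℝ} (hp : 1 < p) (a : ℝ) :
    |a| ^ (p + 1) = |a| ^ (p - 1) * a * a := by
  rw [show p + 1 = (p - 1) + (2 : ℕ) by push_cast; ring,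
    Real.rpow_add_natCast' (abs_nonneg a) (by push_cast; linarith), sq_abs]
  ring

end DirDerivRules

section Wave

/-- The energy density `(∂_t U)² / 2 + |∇U|² / 2 + |U|^{p+1} / (p+1)`. -/
noncomputable def energyDensity (p : ℝ) (U : (Fin 3 → ℝ) × ℝ → ℝ) (q : (Fin 3 → ℝ) × ℝ) : ℝ :=
  1 / 2 * dirDeriv timeDir U q ^ 2 + 1 / 2 * ∑ i, dirDeriv (spaceDir i) U q ^ 2
    + (p + 1)⁻¹ * |U q| ^ (p + 1)

/-- The virial density `U ∂_t U + (x·∇U) ∂_t U`. -/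
noncomputable def virialDensity (U : (Fin 3 → ℝ) × ℝ → ℝ) (q : (Fin 3 → ℝ) × ℝ) : ℝ :=
  U q * dirDeriv timeDir U q + (∑ i, q.1 i * dirDeriv (spaceDir i) U q) * dirDeriv timeDir U q

/-- The flux of the virial density. -/
noncomputable def virialFlux (p : ℝ) (U : (Fin 3 → ℝ) × ℝ → ℝ) (i : Fin 3)
    (q : (Fin 3 → ℝ) × ℝ) : ℝ :=
  1 / 2 * (q.1 i * dirDeriv timeDir U q ^ 2) + U q * dirDeriv (spaceDir i) U q
    + (∑ j, q.1 j * dirDeriv (spaceDir j) U q) * dirDeriv (spaceDir i) U q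
    - 1 / 2 * (q.1 i * ∑ j, dirDeriv (spaceDir j) U q ^ 2)
    - (p + 1)⁻¹ * (q.1 i * |U q| ^ (p + 1))

/-- The source term of the virial identity. -/
noncomputable def virialSource (p : ℝ) (U : (Fin 3 → ℝ) × ℝ → ℝ) (q : (Fin 3 → ℝ) × ℝ) : ℝ :=
  -(1 / 2 * dirDeriv timeDir U q ^ 2) - 1 / 2 * ∑ i, dirDeriv (spaceDir i) U q ^ 2
    - (1 - 3 * (p + 1)⁻¹) * |U q| ^ (p + 1)

variable {p R : ℝ} {U : (Fin 3 → ℝ) × ℝ → ℝ}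

lemma contDiff_energyDensity (hp : 0 < p) (hU : ContDiff ℝ 2 U) :
    ContDiff ℝ 1 (energyDensity p U) := by
  have hv : ∀ w, ContDiff ℝ 1 (dirDeriv w U) := fun w => hU.dirDeriv (by norm_num)
  have h := (hU.of_le (by norm_num)).abs_rpow hp
  unfold energyDensity
  fun_prop

lemma contDiff_virialDensity (hU : ContDiff ℝ 2 U) : ContDiff ℝ 1 (virialDensity U) := by
  have hv : ∀ w, ContDiff ℝ 1 (dirDeriv w U) := fun w => hU.dirDeriv (by norm_num)
  have h : ContDiff ℝ 1 U := hU.of_le (by norm_num)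
  unfold virialDensity
  fun_prop

lemma contDiff_virialFlux (hp : 0 < p) (hU : ContDiff ℝ 2 U) (i : Fin 3) :
    ContDiff ℝ 1 (virialFlux p U i) := by
  have hv : ∀ w, ContDiff ℝ 1 (dirDeriv w U) := fun w => hU.dirDeriv (by norm_num)
  have h : ContDiff ℝ 1 U := hU.of_le (by norm_num)
  have h' := h.abs_rpow hp
  unfold virialFlux
  fun_prop

lemma continuous_virialSource (hp : 0 < p) (hU : ContDiff ℝ 2 U) :
    Continuous (virialSource p U) := by
  have hv : ∀ w, Continuous (dirDeriv w U) := fun w =>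
    (hU.of_le (by norm_num)).continuous_dirDeriv
  have h := ((hU.of_le (by norm_num)).abs_rpow hp).continuous
  unfold virialSource
  fun_prop

lemma VanishesOutside.energyDensity (hp : 0 < p) (hU : VanishesOutside R U) :
    VanishesOutside R (energyDensity p U) := fun q hq => by
  simp [_root_.energyDensity, hU q hq, hU.dirDeriv q hq, Real.zero_rpow (by linarith : p + 1 ≠ 0)]

lemma VanishesOutside.virialDensity (hU : VanishesOutside R U) :
    VanishesOutside R (virialDensity U) := fun q hq => by
  simp [_root_.virialDensity, hU.dirDeriv q hq]

lemma VanishesOutside.virialFlux (hp : 0 < p) (hU : VanishesOutside R U) (i : Fin 3) :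
    VanishesOutside R (virialFlux p U i) := fun q hq => by
  simp [_root_.virialFlux, hU q hq, hU.dirDeriv q hq, Real.zero_rpow (by linarith : p + 1 ≠ 0)]

lemma VanishesOutside.virialSource (hp : 0 < p) (hU : VanishesOutside R U) :
    VanishesOutside R (virialSource p U) := fun q hq => by
  simp [_root_.virialSource, hU q hq, hU.dirDeriv q hq, Real.zero_rpow (by linarith : p + 1 ≠ 0)]

lemma energy_balance (hp : 0 < p) (hU : ContDiff ℝ 2 U)
    (hwave : ∀ q, dirDeriv timeDir (dirDeriv timeDir U) q
      = ∑ i, dirDeriv (spaceDir i) (dirDeriv (spaceDir i) U) q - |U q| ^ (p - 1) * U q)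
    (q : (Fin 3 → ℝ) × ℝ) :
    dirDeriv timeDir (energyDensity p U) q
      = ∑ i, dirDeriv (spaceDir i)
          (fun y => dirDeriv timeDir U y * dirDeriv (spaceDir i) U y) q := by
  have hv : ∀ w, Differentiable ℝ (dirDeriv w U) := fun w =>
    (hU.dirDeriv (m := 1) (by norm_num)).differentiable (by norm_num)
  have hd : Differentiable ℝ U := hU.differentiable (by norm_num)
  have hr := ((hU.of_le (by norm_num)).abs_rpow hp).differentiable (by norm_num)
  have hw := hwave q
  have hp1 : p + 1 ≠ 0 := by linarith
  unfold energyDensity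
  simp only [Fin.sum_univ_three] at hw ⊢
  simp (disch := fun_prop) only [dirDeriv_add, dirDeriv_mul, dirDeriv_sq, dirDeriv_const,
    dirDeriv_abs_rpow hp, dirDeriv_comm hU timeDir (spaceDir _), hw]
  field_simp
  ring

lemma virial_balance (hp : 1 < p) (hU : ContDiff ℝ 2 U)
    (hwave : ∀ q, dirDeriv timeDir (dirDeriv timeDir U) q
      = ∑ i, dirDeriv (spaceDir i) (dirDeriv (spaceDir i) U) q - |U q| ^ (p - 1) * U q)
    (q : (Fin 3 → ℝ) × ℝ) :
    dirDeriv timeDir (virialDensity U) q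
      = ∑ i, dirDeriv (spaceDir i) (virialFlux p U i) q + virialSource p U q := by
  have hv : ∀ w, Differentiable ℝ (dirDeriv w U) := fun w =>
    (hU.dirDeriv (m := 1) (by norm_num)).differentiable (by norm_num)
  have hd : Differentiable ℝ U := hU.differentiable (by norm_num)
  have hp0 : 0 < p := by linarith
  have hr := ((hU.of_le (by norm_num)).abs_rpow hp0).differentiable (by norm_num)
  have hw := hwave q
  have hp1 : p + 1 ≠ 0 := by linarith
  unfold virialDensity virialFlux virialSource
  simp only [Fin.sum_univ_three] at hw ⊢
  simp (disch := fun_prop) only [dirDeriv_add, dirDeriv_sub, dirDeriv_mul, dirDeriv_sq,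
    dirDeriv_const, dirDeriv_coord, dirDeriv_abs_rpow hp0, dirDeriv_comm hU timeDir (spaceDir _),
    dirDeriv_comm hU (spaceDir 1) (spaceDir 0), dirDeriv_comm hU (spaceDir 2) (spaceDir 0),
    dirDeriv_comm hU (spaceDir 2) (spaceDir 1), hw]
  simp [spaceDir, timeDir, abs_rpow_add_one hp]
  field_simp
  ring

lemma energyDensity_nonneg (hp : 0 < p) (q : (Fin 3 → ℝ) × ℝ) : 0 ≤ energyDensity p U q := by
  unfold energyDensity
  positivity

lemma virialSource_le (hp : 5 ≤ p) (q : (Fin 3 → ℝ) × ℝ) :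
    virialSource p U q ≤ -energyDensity p U q := by
  have h : (p + 1)⁻¹ ≤ 1 / 4 := by
    rw [inv_le_comm₀ (by linarith) (by norm_num)]
    linarith
  have h' : 0 ≤ |U q| ^ (p + 1) := by positivity
  unfold virialSource energyDensity
  nlinarith

/-- Inside the cylinder, the virial density is controlled by the energy density. -/
lemma abs_virialDensity_le (hp : 1 ≤ p) (hR : 0 ≤ R) {q : (Fin 3 → ℝ) × ℝ}
    (hq : ∑ i, q.1 i ^ 2 ≤ R ^ 2) :
    |virialDensity U q| ≤ 1 + (2 + p + 3 * R) * energyDensity p U q := by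
  set v := dirDeriv timeDir U q with hv
  set S := ∑ i, dirDeriv (spaceDir i) U q ^ 2 with hS
  set H := |U q| ^ (p + 1) with hH
  have hH0 : 0 ≤ H := by positivity
  have hS0 : 0 ≤ S := by positivity
  have hUsq : U q ^ 2 ≤ 1 + H := by
    rcases le_total |U q| 1 with h | h
    · have : U q ^ 2 ≤ 1 := by rw [← sq_abs]; exact pow_le_one₀ (abs_nonneg _) h
      linarith
    · have : |U q| ^ (2 : ℝ) ≤ H := Real.rpow_le_rpow_of_exponent_le h (by linarith)
      rw [Real.rpow_two, sq_abs] at this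
      linarith
  have h1 : |U q * v| ≤ 1 / 2 * (1 + H) + 1 / 2 * v ^ 2 := by
    rw [abs_le]
    constructor <;> nlinarith [sq_nonneg (U q - v), sq_nonneg (U q + v)]
  have h2 : |(∑ i, q.1 i * dirDeriv (spaceDir i) U q) * v| ≤ R * (1 / 2 * S + 3 / 2 * v ^ 2) := by
    rw [Finset.sum_mul]
    refine (Finset.abs_sum_le_sum_abs _ _).trans ?_
    have : ∀ i, |q.1 i * dirDeriv (spaceDir i) U q * v|
        ≤ R * (1 / 2 * dirDeriv (spaceDir i) U q ^ 2 + 1 / 2 * v ^ 2) := by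
      intro i
      rw [mul_assoc, abs_mul]
      refine mul_le_mul (abs_le_of_sum_sq_le hR hq i) ?_ (abs_nonneg _) hR
      rw [abs_le]
      constructor <;> nlinarith [sq_nonneg (dirDeriv (spaceDir i) U q - v),
        sq_nonneg (dirDeriv (spaceDir i) U q + v)]
    refine (Finset.sum_le_sum fun i _ => this i).trans (le_of_eq ?_)
    rw [hS, Fin.sum_univ_three, Fin.sum_univ_three]
    ring
  have h3 : energyDensity p U q = 1 / 2 * v ^ 2 + 1 / 2 * S + (p + 1)⁻¹ * H := rfl
  have hp1 : 0 < p + 1 := by linarith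
  have h4 : (p + 1) * ((p + 1)⁻¹ * H) = H := by field_simp
  set K := (p + 1)⁻¹ * H
  have hK : 0 ≤ K := by positivity
  have h5 : |virialDensity U q| ≤ |U q * v| + |(∑ i, q.1 i * dirDeriv (spaceDir i) U q) * v| :=
    abs_add_le _ _
  rw [h3]
  have hv0 := sq_nonneg v
  nlinarith [mul_nonneg hR hS0, mul_nonneg hR hv0, mul_nonneg hR hK,
    mul_nonneg (by linarith : 0 ≤ p) hS0, mul_nonneg (by linarith : 0 ≤ p) hv0]

lemma abs_integral_virialDensity_le (hp : 1 ≤ p) (hR : 0 ≤ R) (hU : ContDiff ℝ 2 U)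
    (hsupp : VanishesOutside R U) (t : ℝ) :
    |∫ x, virialDensity U (x, t)| ≤ volume.real (Metric.closedBall (0 : Fin 3 → ℝ) R)
      + (2 + p + 3 * R) * ∫ x, energyDensity p U (x, t) := by
  have hp0 : 0 < p := by linarith
  have hie := (hsupp.energyDensity hp0).integrable hR
    (contDiff_energyDensity hp0 hU).continuous t
  have hib : Integrable ((Metric.closedBall (0 : Fin 3 → ℝ) R).indicator fun _ => (1 : ℝ)) :=
    (integrable_indicator_iff measurableSet_closedBall).2
      (integrableOn_const (by exact (isCompact_closedBall _ _).measure_lt_top.ne))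
  calc |∫ x, virialDensity U (x, t)| ≤ ∫ x, |virialDensity U (x, t)| := abs_integral_le_integral_abs
    _ ≤ ∫ x, ((Metric.closedBall (0 : Fin 3 → ℝ) R).indicator (fun _ => (1 : ℝ)) x
          + (2 + p + 3 * R) * energyDensity p U (x, t)) := by
        refine integral_mono (hsupp.virialDensity.integrable hR
          (contDiff_virialDensity hU).continuous t).abs (hib.add (hie.const_mul _)) fun x => ?_
        by_cases hx : ∑ i, x i ^ 2 ≤ R ^ 2
        · have hmem : x ∈ Metric.closedBall (0 : Fin 3 → ℝ) R := by
            rw [mem_closedBall_zero_iff, pi_norm_le_iff_of_nonneg hR]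
            exact abs_le_of_sum_sq_le hR hx
          simpa [hmem] using abs_virialDensity_le (q := (x, t)) hp hR hx
        · have h0 : virialDensity U (x, t) = 0 := hsupp.virialDensity _ (not_le.1 hx)
          have h1 := energyDensity_nonneg (U := U) hp0 (x, t)
          simp only [h0, abs_zero]
          exact add_nonneg (Set.indicator_nonneg (fun _ _ => zero_le_one) _) (by positivity)
    _ = _ := by
        rw [integral_add hib (hie.const_mul _), integral_const_mul,
          integral_indicator measurableSet_closedBall]
        simp

lemma eq_zero_of_wave (hp : 5 ≤ p) (hR : 0 ≤ R) (hU : ContDiff ℝ 2 U)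
    (hsupp : VanishesOutside R U)
    (hwave : ∀ q, dirDeriv timeDir (dirDeriv timeDir U) q
      = ∑ i, dirDeriv (spaceDir i) (dirDeriv (spaceDir i) U) q - |U q| ^ (p - 1) * U q)
    (q : (Fin 3 → ℝ) × ℝ) : U q = 0 := by
  have hp0 : 0 < p := by linarith
  have hv : ∀ w, ContDiff ℝ 1 (dirDeriv w U) := fun w => hU.dirDeriv (by norm_num)
  have heC := contDiff_energyDensity hp0 hU
  have heV := hsupp.energyDensity hp0
  have hE' : ∀ t, HasDerivAt (fun τ => ∫ x, energyDensity p U (x, τ)) 0 t := fun t => by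
    have h := hasDerivAt_integral_of_balance hR heV heC
      (Φ := fun i y => dirDeriv timeDir U y * dirDeriv (spaceDir i) U y) (G := fun _ => 0)
      (fun i y hy => by simp [hsupp.dirDeriv y hy]) (fun i => (hv _).mul (hv _))
      (fun y => by rw [energy_balance hp0 hU hwave, add_zero]) t
    simpa using h
  obtain ⟨E, hE⟩ : ∃ E, ∀ t, ∫ x, energyDensity p U (x, t) = E :=
    ⟨_, fun t => is_const_of_deriv_eq_zero (fun t => (hE' t).differentiableAt)
      (fun t => (hE' t).deriv) t 0⟩
  have hE0 : 0 ≤ E := hE 0 ▸ integral_nonneg fun x => energyDensity_nonneg hp0 _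
  have hz' : ∀ t, HasDerivAt (fun τ => ∫ x, virialDensity U (x, τ))
      (∫ x, virialSource p U (x, t)) t :=
    hasDerivAt_integral_of_balance hR hsupp.virialDensity (contDiff_virialDensity hU)
      (hsupp.virialFlux hp0) (contDiff_virialFlux hp0 hU)
      (virial_balance (by linarith) hU hwave)
  have hsource : ∀ t, ∫ x, virialSource p U (x, t) ≤ -E := fun t => by
    rw [← hE t, ← integral_neg]
    exact integral_mono
      ((hsupp.virialSource hp0).integrable hR (continuous_virialSource hp0 hU) t)
      (heV.integrable hR heC.continuous t).neg fun x => virialSource_le hp _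
  obtain ⟨M, hM⟩ : ∃ M, ∀ t, |∫ x, virialDensity U (x, t)| ≤ M :=
    ⟨volume.real (Metric.closedBall (0 : Fin 3 → ℝ) R) + (2 + p + 3 * R) * E, fun t =>
      hE t ▸ abs_integral_virialDensity_le (by linarith) hR hU hsupp t⟩
  have hdecay : ∀ t, 0 ≤ t →
      (∫ x, virialDensity U (x, t)) - ∫ x, virialDensity U (x, 0) ≤ -E * (t - 0) := fun t ht =>
    image_sub_le_mul_sub_of_deriv_le (fun t => (hz' t).differentiableAt)
      (fun t => (hz' t).deriv ▸ hsource t) ht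
  have hEzero : E = 0 := by
    by_contra hne
    have hpos : 0 < E := lt_of_le_of_ne hE0 (Ne.symm hne)
    have hM0 : 0 ≤ M := (abs_nonneg _).trans (hM 0)
    have h := hdecay ((2 * M + 1) / E) (by positivity)
    have h1 := (abs_le.1 (hM ((2 * M + 1) / E))).1
    have h2 := (abs_le.1 (hM 0)).2
    rw [sub_zero, neg_mul, mul_div_cancel₀ _ hne] at h
    linarith
  obtain ⟨x, t⟩ := q
  have hcont : Continuous fun x => energyDensity p U (x, t) :=
    heC.continuous.comp (by fun_prop)
  have he : energyDensity p U (x, t) = 0 := by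
    by_contra hne
    have h := hcont.integral_pos_of_hasCompactSupport_nonneg_nonzero (μ := volume)
      (heV.hasCompactSupport hR t) (fun x => energyDensity_nonneg hp0 _) hne
    rw [hE t, hEzero] at h
    exact lt_irrefl _ h
  by_contra hne
  have : 0 < energyDensity p U (x, t) := by
    unfold energyDensity
    positivity
  exact this.ne' he

end Wave

/-- The rigidity mechanism of Proposition 5.5: for `p ≥ 5`, a global classical solution
of the defocusing nonlinear wave equation `∂_t² u = Δu − |u|^{p−1}u` in ℝ³ which is
supported, for every time, in a fixed ball `{|x| ≤ R}` must vanish identically. -/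
theorem stmt_18 (p : ℝ) (hp : 5 ≤ p)
    (u : (Fin 3 → ℝ) → ℝ → ℝ)
    (hu : ContDiff ℝ 2 (fun q : (Fin 3 → ℝ) × ℝ => u q.1 q.2))
    (hpde : ∀ (x : Fin 3 → ℝ) (t : ℝ),
      deriv (fun τ => deriv (fun σ => u x σ) τ) t
        = lap (fun y => u y t) x - |u x t| ^ (p - 1) * u x t)
    (R : ℝ) (hR : 0 < R)
    (hsupp : ∀ (t : ℝ) (x : Fin 3 → ℝ), R ^ 2 < ∑ i, x i ^ 2 → u x t = 0) :
    ∀ (x : Fin 3 → ℝ) (t : ℝ), u x t = 0 := by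
  have hd : ∀ w, Differentiable ℝ (dirDeriv w fun q : (Fin 3 → ℝ) × ℝ => u q.1 q.2) := fun w =>
    (hu.dirDeriv (m := 1) (by norm_num)).differentiable (by norm_num)
  have hud := hu.differentiable (by norm_num)
  intro x t
  refine eq_zero_of_wave (U := fun q => u q.1 q.2) hp hR.le hu (fun q hq => hsupp q.2 q.1 hq)
    (fun q => ?_) (x, t)
  obtain ⟨y, s⟩ := q
  have htime : deriv (fun τ => deriv (fun σ => u y σ) τ) s
      = dirDeriv timeDir (dirDeriv timeDir fun q : (Fin 3 → ℝ) × ℝ => u q.1 q.2) (y, s) := by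
    rw [funext fun τ => (hasDerivAt_time hud y τ).deriv]
    exact (hasDerivAt_time (hd _) y s).deriv
  have hspace : lap (fun z => u z s) y = ∑ i, dirDeriv (spaceDir i)
      (dirDeriv (spaceDir i) fun q : (Fin 3 → ℝ) × ℝ => u q.1 q.2) (y, s) := by
    refine Finset.sum_congr rfl fun i _ => ?_
    rw [funext fun σ => (hasDerivAt_space hud y s i σ).deriv,
      (hasDerivAt_space (hd _) y s i (y i)).deriv, Function.update_eq_self]
  rw [← htime, ← hspace]
  exact hpde y s
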